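/- arXiv:2209.01770 — 5 statements merged into one kernel-verified Lean document; each statement's English description precedes it below -/
import Mathlib

section
/- Let E be a real Banach space, P ⊆ E a cone (P is closed, P ≠ {0}, ax + by ∈ P for all x, y ∈ P and all reals a, b ≥ 0, and P ∩ (−P) = {0}), with the partial order x ≤ y iff y − x ∈ P. Let (X, p) be a partial cone metric space over (E, P). Then the map d : X × X → E defined by d(x,y) = 2·p(x,y) − p(x,x) − p(y,y) is a cone metric on X; that is, for all x, y, z ∈ X: d(x,y) ∈ P; d(x,y) = 0 if and only if x = y; d(x,y) = d(y,x); and d(x,y) ≤ d(x,z) + d(z,y). -/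
/-- The map `d(x,y) = 2·p(x,y) − p(x,x) − p(y,y)` induced by a partial cone
metric `p` on `X` over a cone `P` in a real Banach space `E` is a cone metric on `X`. -/
theorem induced_cone_metric_of_partial_cone_metric
    {E : Type*} [NormedAddCommGroup E] [NormedSpace ℝ E] [CompleteSpace E]
    (P : Set E) (hPclosed : IsClosed P) (hPnonempty : P.Nonempty) (hPne : P ≠ {0})
    (hPcone : ∀ x ∈ P, ∀ y ∈ P, ∀ a b : ℝ, 0 ≤ a → 0 ≤ b → a • x + b • y ∈ P)
    (hPpointed : P ∩ (-P) = {0})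
    {X : Type*} [Nonempty X] (p : X → X → E)
    (hp1 : ∀ x y : X, p x x ∈ P ∧ p x y - p x x ∈ P)
    (hp2 : ∀ x y : X, x = y ↔ (p x x = p x y ∧ p x y = p y y))
    (hp3 : ∀ x y : X, p x y = p y x)
    (hp4 : ∀ x y z : X, p x z + p z y - p z z - p x y ∈ P)
    (d : X → X → E) (hd : ∀ x y : X, d x y = (2 : ℝ) • p x y - p x x - p y y) :
    ∀ x y z : X,
      d x y ∈ P ∧
      (d x y = 0 ↔ x = y) ∧
      d x y = d y x ∧
      d x z + d z y - d x y ∈ P := by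
  have add_mem : ∀ {u v : E}, u ∈ P → v ∈ P → u + v ∈ P := fun {u v} hu hv => by
    simpa using hPcone u hu v hv 1 1 zero_le_one zero_le_one
  have d_eq : ∀ x y, d x y = (p x y - p x x) + (p x y - p y y) := fun x y => by
    rw [hd, two_smul]
    abel
  have sub_mem : ∀ x y, p x y - p y y ∈ P := fun x y => by
    rw [hp3 x y]
    exact (hp1 y x).2
  intro x y z
  refine ⟨?_, ⟨fun h => ?_, ?_⟩, ?_, ?_⟩
  · rw [d_eq]
    exact add_mem (hp1 x y).2 (sub_mem x y)
  · rw [d_eq] at h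
    have hx : p x y - p x x = 0 := by
      have hmem : p x y - p x x ∈ P ∩ (-P) := by
        refine ⟨(hp1 x y).2, ?_⟩
        rw [Set.mem_neg, neg_eq_of_add_eq_zero_right h]
        exact sub_mem x y
      rwa [hPpointed] at hmem
    rw [hx, zero_add] at h
    exact (hp2 x y).2 ⟨(sub_eq_zero.1 hx).symm, sub_eq_zero.1 h⟩
  · rintro rfl
    rw [d_eq, sub_self, add_zero]
  · rw [d_eq, d_eq, hp3 y x, add_comm]
  · have h := add_mem (hp4 x y z) (hp4 x y z)
    convert h using 1
    rw [d_eq, d_eq, d_eq]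
    abel
end

section
/- Let E be a real Banach space, P ⊆ E a cone (closed, P ≠ {0}, closed under nonnegative real linear combinations, P ∩ (−P) = {0}) ordered by x ≤ y iff y − x ∈ P, and assume P is normal with constant M > 0 (0 ≤ x ≤ y implies ‖x‖ ≤ M‖y‖). Let (X, p) be a partial cone metric space over (E, P) and let d(x,y) = 2·p(x,y) − p(x,x) − p(y,y) be the induced cone metric. If a sequence (x_n) in X is Cauchy in (X, p) (i.e., there exists a ∈ P such that for every ε > 0 there is N with ‖p(x_n, x_m) − a‖ < ε for all n, m > N), then (x_n) is Cauchy in the cone metric space (X, d), i.e., ‖d(x_n, x_m)‖ → 0 as n, m → ∞. -/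
/-- If `P` is a normal cone with normal constant `M` and `(x n)` is a Cauchy
sequence in the partial cone metric space `(X, p)`, then `(x n)` is Cauchy in the induced
cone metric space `(X, d)` with `d(x,y) = 2·p(x,y) − p(x,x) − p(y,y)`, i.e.
`‖d(x n, x m)‖ → 0` as `n, m → ∞`. -/
theorem cauchy_in_cone_metric_of_cauchy_in_partial_cone_metric
    {E : Type*} [NormedAddCommGroup E] [NormedSpace ℝ E] [CompleteSpace E]
    (P : Set E) (hPclosed : IsClosed P) (hPnonempty : P.Nonempty) (hPne : P ≠ {0})
    (hPcone : ∀ x ∈ P, ∀ y ∈ P, ∀ a b : ℝ, 0 ≤ a → 0 ≤ b → a • x + b • y ∈ P)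
    (hPpointed : P ∩ (-P) = {0})
    (M : ℝ) (hM : 0 < M)
    (hPnormal : ∀ u v : E, u ∈ P → v - u ∈ P → ‖u‖ ≤ M * ‖v‖)
    {X : Type*} [Nonempty X] (p : X → X → E)
    (hp1 : ∀ x y : X, p x x ∈ P ∧ p x y - p x x ∈ P)
    (hp2 : ∀ x y : X, x = y ↔ (p x x = p x y ∧ p x y = p y y))
    (hp3 : ∀ x y : X, p x y = p y x)
    (hp4 : ∀ x y z : X, p x z + p z y - p z z - p x y ∈ P)
    (d : X → X → E) (hd : ∀ x y : X, d x y = (2 : ℝ) • p x y - p x x - p y y)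
    (x : ℕ → X)
    (hcauchy : ∃ a ∈ P, ∀ ε : ℝ, 0 < ε → ∃ N : ℕ, ∀ n m : ℕ, N < n → N < m →
      ‖p (x n) (x m) - a‖ < ε) :
    ∀ ε : ℝ, 0 < ε → ∃ N : ℕ, ∀ n m : ℕ, N < n → N < m → ‖d (x n) (x m)‖ < ε := by
  intro ε hε
  obtain ⟨a, -, ha⟩ := hcauchy
  obtain ⟨N, hN⟩ := ha (ε / 4) (by positivity)
  refine ⟨N, fun n m hn hm => ?_⟩
  have h_decomp : d (x n) (x m) =
      (p (x n) (x m) - a) + (p (x n) (x m) - a) - (p (x n) (x n) - a) - (p (x m) (x m) - a) := by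
    rw [hd, two_smul]
    abel
  rw [h_decomp]
  have h_diff := norm_sub_le
    ((p (x n) (x m) - a) + (p (x n) (x m) - a) - (p (x n) (x n) - a)) (p (x m) (x m) - a)
  have h_diff' := norm_sub_le
    ((p (x n) (x m) - a) + (p (x n) (x m) - a)) (p (x n) (x n) - a)
  have h_add := norm_add_le (p (x n) (x m) - a) (p (x n) (x m) - a)
  linarith [hN n m hn hm, hN n n hn hn, hN m m hm hm]
end

section
/- Let (X, p) be a partial metric space and let A, B be nonempty, bounded subsets of X with B closed (with respect to the topology generated by the balls B_p(x,ε) = {y : p(x,y) < p(x,x) + ε}). Then for every h > 1 and every a ∈ A there exists b ∈ B such that p(a, b) ≤ h · H_p(A, B). -/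
/-- The topology of a partial metric space, generated by the open balls
`B_p(x, ε) = {y : p x y < p x x + ε}`. -/
def pmTop {X : Type*} (p : X → X → ℝ) : TopologicalSpace X :=
  TopologicalSpace.generateFrom
    {s : Set X | ∃ c : X, ∃ ε : ℝ, 0 < ε ∧ s = {y : X | p c y < p c c + ε}}

/-- `p(x, A) = inf {p(x, a) : a ∈ A}`. -/
noncomputable def pmDist {X : Type*} (p : X → X → ℝ) (x : X) (A : Set X) : ℝ :=
  sInf ((fun a => p x a) '' A)

/-- `δ_p(A, B) = sup {p(a, B) : a ∈ A}`. -/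
noncomputable def pmDelta {X : Type*} (p : X → X → ℝ) (A B : Set X) : ℝ :=
  sSup ((fun a => pmDist p a B) '' A)

/-- `H_p(A, B) = max {δ_p(A, B), δ_p(B, A)}`. -/
noncomputable def pmH {X : Type*} (p : X → X → ℝ) (A B : Set X) : ℝ :=
  max (pmDelta p A B) (pmDelta p B A)

/-- A subset `A` is bounded if there are `x₀ ∈ X` and `M ≥ 0` with `p x₀ a ≤ M` for all
`a ∈ A`. -/
def pmBounded {X : Type*} (p : X → X → ℝ) (A : Set X) : Prop :=
  ∃ x₀ : X, ∃ M : ℝ, 0 ≤ M ∧ ∀ a ∈ A, p x₀ a ≤ M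

/-- In a partial metric space every open set contains a ball around each of its points. -/
theorem exists_ball_subset_of_isOpen_pmTop {X : Type*} {p : X → X → ℝ}
    (hp4 : ∀ x y z : X, p x y ≤ p x z + p z y - p z z) {U : Set X}
    (hU : @IsOpen X (pmTop p) U) :
    ∀ x ∈ U, ∃ ε > 0, {y : X | p x y < p x x + ε} ⊆ U := by
  induction hU with
  | basic s hs =>
    obtain ⟨c, ε, -, rfl⟩ := hs
    intro x hx
    have hx' : p c x < p c c + ε := hx
    refine ⟨p c c + ε - p c x, by linarith, fun y hy => ?_⟩
    have hy' : p x y < p x x + (p c c + ε - p c x) := hy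
    show p c y < p c c + ε
    linarith [hp4 c y x]
  | univ => exact fun x _ => ⟨1, one_pos, Set.subset_univ _⟩
  | inter s t _ _ ihs iht =>
    intro x hx
    obtain ⟨ε, hε, hs⟩ := ihs x hx.1
    obtain ⟨δ, hδ, ht⟩ := iht x hx.2
    refine ⟨min ε δ, lt_min hε hδ, fun y hy => ?_⟩
    have hy' : p x y < p x x + min ε δ := hy
    have hs' : p x y < p x x + ε := by linarith [min_le_left ε δ]
    have ht' : p x y < p x x + δ := by linarith [min_le_right ε δ]
    exact ⟨hs hs', ht ht'⟩
  | sUnion S _ ih =>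
    rintro x ⟨s, hs, hx⟩
    obtain ⟨ε, hε, h⟩ := ih s hs x hx
    exact ⟨ε, hε, h.trans (Set.subset_sUnion_of_mem hs)⟩

/-- A point whose distance to a nonempty closed set equals its self-distance lies in the set. -/
theorem mem_of_pmDist_le_self {X : Type*} {p : X → X → ℝ}
    (hp4 : ∀ x y z : X, p x y ≤ p x z + p z y - p z z) {B : Set X} (hB : B.Nonempty)
    (hBclosed : @IsClosed X (pmTop p) B) {x : X} (hx : pmDist p x B ≤ p x x) : x ∈ B := by
  by_contra hxB
  obtain ⟨ε, hε, hsub⟩ :=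
    exists_ball_subset_of_isOpen_pmTop hp4 hBclosed.isOpen_compl x hxB
  have hlt : pmDist p x B < p x x + ε := by linarith
  obtain ⟨_, ⟨b, hb, rfl⟩, hxb⟩ := exists_lt_of_csInf_lt (hB.image _) hlt
  exact hsub hxb hb

/-- The distance from a point of a bounded set `A` to a nonempty set `B` is at most
`δ_p(A, B)`. -/
theorem pmDist_le_pmDelta {X : Type*} {p : X → X → ℝ} (hp0 : ∀ x y : X, 0 ≤ p x y)
    (hp3 : ∀ x y : X, p x y = p y x)
    (hp4 : ∀ x y z : X, p x y ≤ p x z + p z y - p z z) {A B : Set X} (hB : B.Nonempty)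
    (hAb : pmBounded p A) {a : X} (ha : a ∈ A) : pmDist p a B ≤ pmDelta p A B := by
  obtain ⟨x₀, M, -, hM⟩ := hAb
  obtain ⟨b, hb⟩ := hB
  refine le_csSup ⟨M + p x₀ b, ?_⟩ (Set.mem_image_of_mem _ ha)
  rintro _ ⟨c, hc, rfl⟩
  have hle : pmDist p c B ≤ p c b :=
    csInf_le ⟨0, by rintro _ ⟨y, -, rfl⟩; exact hp0 c y⟩ (Set.mem_image_of_mem _ hb)
  linarith [hp4 c b x₀, hp3 c x₀, hM c hc, hp0 x₀ x₀]

/-- If `A, B` are nonempty bounded subsets of a partial metric space with `B`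
closed, then for every `h > 1` and every `a ∈ A` there is `b ∈ B` with
`p(a, b) ≤ h · H_p(A, B)`. -/
theorem exists_approx_nearest_point_of_hausdorff
    {X : Type*} [Nonempty X] (p : X → X → ℝ)
    (hp1 : ∀ x y : X, 0 ≤ p x x ∧ p x x ≤ p x y)
    (hp2 : ∀ x y : X, x = y ↔ (p x x = p x y ∧ p x y = p y y))
    (hp3 : ∀ x y : X, p x y = p y x)
    (hp4 : ∀ x y z : X, p x y ≤ p x z + p z y - p z z)
    (A B : Set X) (hA : A.Nonempty) (hB : B.Nonempty)
    (hAb : pmBounded p A) (hBb : pmBounded p B)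
    (hBclosed : @IsClosed X (pmTop p) B) :
    ∀ h : ℝ, 1 < h → ∀ a ∈ A, ∃ b ∈ B, p a b ≤ h * pmH p A B := by
  intro h hh a ha
  have hself : p a a ≤ pmDist p a B :=
    le_csInf (hB.image _) (by rintro _ ⟨y, -, rfl⟩; exact (hp1 a y).2)
  have hdist : pmDist p a B ≤ pmH p A B :=
    (pmDist_le_pmDelta (fun x y => (hp1 x y).1.trans (hp1 x y).2) hp3 hp4 hB hAb ha).trans
      (le_max_left _ _)
  have h0 : 0 ≤ p a a := (hp1 a a).1
  rcases (h0.trans (hself.trans hdist)).eq_or_lt with hH | hH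
  · refine ⟨a, mem_of_pmDist_le_self hp4 hB hBclosed (by linarith), ?_⟩
    rw [← hH, mul_zero]
    linarith
  · have hlt : pmDist p a B < h * pmH p A B :=
      hdist.trans_lt (lt_mul_of_one_lt_left hH hh)
    obtain ⟨_, ⟨b, hb, rfl⟩, hab⟩ := exists_lt_of_csInf_lt (hB.image _) hlt
    exact ⟨b, hb, hab.le⟩
end

section
/- (Nadler-type contraction theorem on partial metric spaces) Let (X, p) be a complete partial metric space and let T be a map assigning to each x ∈ X a nonempty, closed (in the partial metric topology), bounded subset Tx ⊆ X. Suppose there is a constant k ∈ (0, 1) such that H_p(Tx, Ty) ≤ k·p(x, y) for all x, y ∈ X. Then T has a fixed point: there exists x ∈ X with x ∈ Tx. -/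
/-- `p(A, x) = inf {p(a, x) : a ∈ A}`. -/
noncomputable def pmDistL {X : Type*} (p : X → X → ℝ) (A : Set X) (x : X) : ℝ :=
  sInf ((fun a => p a x) '' A)

/-- A sequence is Cauchy in a partial metric space if `p (x n) (x m)` converges to some
real number as `n, m → ∞`. -/
def pmCauchy {X : Type*} (p : X → X → ℝ) (x : ℕ → X) : Prop :=
  ∃ a : ℝ, Filter.Tendsto (fun q : ℕ × ℕ => p (x q.1) (x q.2))
    (Filter.atTop ×ˢ Filter.atTop) (nhds a)

/-- A sequence converges to `l` in a partial metric space if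
`lim p (x n) l = lim p (x n) (x n) = p l l`. -/
def pmConvergesTo {X : Type*} (p : X → X → ℝ) (x : ℕ → X) (l : X) : Prop :=
  Filter.Tendsto (fun n => p (x n) l) Filter.atTop (nhds (p l l)) ∧
  Filter.Tendsto (fun n => p (x n) (x n)) Filter.atTop (nhds (p l l))

/-- A partial metric space is complete if every Cauchy sequence converges. -/
def pmComplete {X : Type*} (p : X → X → ℝ) : Prop :=
  ∀ x : ℕ → X, pmCauchy p x → ∃ l : X, pmConvergesTo p x l

/-- Every open set of a partial metric space contains a ball around each of its points. -/
theorem exists_ball_subset_of_isOpen {X : Type*} {p : X → X → ℝ}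
    (hp4 : ∀ x y z : X, p x y ≤ p x z + p z y - p z z)
    {U : Set X} (hU : @IsOpen X (pmTop p) U) {x : X} (hx : x ∈ U) :
    ∃ ε : ℝ, 0 < ε ∧ ∀ y, p x y < p x x + ε → y ∈ U := by
  change TopologicalSpace.GenerateOpen _ U at hU
  induction hU with
  | basic s hs =>
    obtain ⟨c, ε, -, rfl⟩ := hs
    simp only [Set.mem_ofPred_eq] at hx ⊢
    refine ⟨p c c + ε - p c x, by linarith, fun y hy => ?_⟩
    linarith [hp4 c y x]
  | univ => exact ⟨1, one_pos, fun _ _ => trivial⟩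
  | inter s t _ _ hs ht =>
    obtain ⟨ε, hε, h⟩ := hs hx.1
    obtain ⟨η, hη, h'⟩ := ht hx.2
    exact ⟨min ε η, lt_min hε hη, fun y hy =>
      ⟨h y (by linarith [min_le_left ε η]), h' y (by linarith [min_le_right ε η])⟩⟩
  | sUnion S _ hS =>
    obtain ⟨s, hs, hxs⟩ := hx
    obtain ⟨ε, hε, h⟩ := hS s hs hxs
    exact ⟨ε, hε, fun y hy => ⟨s, hs, h y hy⟩⟩

/-- A point at partial distance zero from a closed set (and with zero self-distance) lies in
the set. -/
theorem mem_of_isClosed_of_forall_exists_lt {X : Type*} {p : X → X → ℝ}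
    (hp4 : ∀ x y z : X, p x y ≤ p x z + p z y - p z z)
    {A : Set X} (hA : @IsClosed X (pmTop p) A) {x : X} (hxx : p x x = 0)
    (h : ∀ ε : ℝ, 0 < ε → ∃ a ∈ A, p x a < ε) : x ∈ A := by
  by_contra hx
  obtain ⟨ε, hε, hball⟩ :=
    exists_ball_subset_of_isOpen hp4 (@IsClosed.isOpen_compl X (pmTop p) A hA) hx
  obtain ⟨a, ha, hlt⟩ := h ε hε
  exact hball a (by linarith) ha

/-- For bounded sets, the distance of a point of `A` to `B` is at most `H_p(A, B)`. -/
theorem pmDist_le_pmH {X : Type*} {p : X → X → ℝ}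
    (hp1 : ∀ x y : X, 0 ≤ p x x ∧ p x x ≤ p x y)
    (hp3 : ∀ x y : X, p x y = p y x)
    (hp4 : ∀ x y z : X, p x y ≤ p x z + p z y - p z z)
    {A B : Set X} (hA : pmBounded p A) (hB : B.Nonempty) {a : X} (ha : a ∈ A) :
    pmDist p a B ≤ pmH p A B := by
  obtain ⟨c, M, -, hM⟩ := hA
  obtain ⟨b, hb⟩ := hB
  refine le_trans (le_csSup ?_ (Set.mem_image_of_mem (fun a => pmDist p a B) ha))
    (le_max_left (pmDelta p A B) (pmDelta p B A))
  refine ⟨M + p c b, ?_⟩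
  rintro _ ⟨a', ha', rfl⟩
  have hle : pmDist p a' B ≤ p a' b := by
    refine csInf_le ⟨0, ?_⟩ (Set.mem_image_of_mem _ hb)
    rintro _ ⟨b', -, rfl⟩
    exact (hp1 a' b').1.trans (hp1 a' b').2
  have h := hM a' ha'
  rw [hp3] at h
  change pmDist p a' B ≤ M + p c b
  linarith [hp4 a' b c, (hp1 c c).1]

/-- For bounded sets, every point of `A` has a point of `B` at distance below any number
exceeding `H_p(A, B)`. -/
theorem exists_lt_of_pmH_lt {X : Type*} {p : X → X → ℝ}
    (hp1 : ∀ x y : X, 0 ≤ p x x ∧ p x x ≤ p x y)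
    (hp3 : ∀ x y : X, p x y = p y x)
    (hp4 : ∀ x y z : X, p x y ≤ p x z + p z y - p z z)
    {A B : Set X} (hA : pmBounded p A) (hB : B.Nonempty) {a : X} (ha : a ∈ A)
    {r : ℝ} (hr : pmH p A B < r) : ∃ b ∈ B, p a b < r := by
  obtain ⟨_, ⟨b, hb, rfl⟩, hlt⟩ := exists_lt_of_csInf_lt (hB.image (fun b => p a b))
    ((pmDist_le_pmH hp1 hp3 hp4 hA hB ha).trans_lt hr)
  exact ⟨b, hb, hlt⟩

/-- A sequence whose consecutive distances decay geometrically has all mutual distances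
tending to zero. -/
theorem tendsto_zero_of_le_geometric {X : Type*} {p : X → X → ℝ}
    (hp1 : ∀ x y : X, 0 ≤ p x x ∧ p x x ≤ p x y)
    (hp3 : ∀ x y : X, p x y = p y x)
    (hp4 : ∀ x y z : X, p x y ≤ p x z + p z y - p z z)
    {h d : ℝ} (h0 : 0 ≤ h) (h1 : h < 1) {x : ℕ → X}
    (hx : ∀ n, p (x n) (x (n + 1)) ≤ d * h ^ n) :
    Filter.Tendsto (fun q : ℕ × ℕ => p (x q.1) (x q.2))
      (Filter.atTop ×ˢ Filter.atTop) (nhds 0) := by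
  have hnn : ∀ y z, 0 ≤ p y z := fun y z => (hp1 y z).1.trans (hp1 y z).2
  have hd : 0 ≤ d := by simpa using (hnn _ _).trans (hx 0)
  obtain ⟨C, hC⟩ : ∃ C, C = d + C * h :=
    ⟨d / (1 - h), by have : 1 - h ≠ 0 := by linarith
                     field_simp
                     ring⟩
  have hC0 : 0 ≤ C := by nlinarith
  have hbound : ∀ j n, p (x n) (x (n + j)) ≤ C * h ^ n := by
    intro j
    induction j with
    | zero =>
      intro n
      have hdC : d * h ^ n ≤ C * h ^ n :=
        mul_le_mul_of_nonneg_right (by nlinarith) (pow_nonneg h0 n)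
      exact ((hp1 _ _).2.trans (hx n)).trans hdC
    | succ j ih =>
      intro n
      have hstep := ih (n + 1)
      rw [show n + 1 + j = n + (j + 1) by ring] at hstep
      have hsum : C * h ^ n = d * h ^ n + C * h ^ (n + 1) := by
        rw [pow_succ]
        linear_combination h ^ n * hC
      linarith [hp4 (x n) (x (n + (j + 1))) (x (n + 1)), hx n, hnn (x (n + 1)) (x (n + 1))]
  have hpow : Filter.Tendsto (fun n : ℕ => C * h ^ n) Filter.atTop (nhds 0) := by
    simpa using (tendsto_pow_atTop_nhds_zero_of_lt_one h0 h1).const_mul C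
  have hlim : Filter.Tendsto (fun q : ℕ × ℕ => C * h ^ q.1 + C * h ^ q.2)
      (Filter.atTop ×ˢ Filter.atTop) (nhds 0) := by
    simpa using (hpow.comp Filter.tendsto_fst).add (hpow.comp Filter.tendsto_snd)
  refine squeeze_zero (fun q => hnn _ _) (fun q => ?_) hlim
  have hq1 : 0 ≤ C * h ^ q.1 := by positivity
  have hq2 : 0 ≤ C * h ^ q.2 := by positivity
  rcases le_total q.1 q.2 with hle | hle
  · have := hbound (q.2 - q.1) q.1
    rw [Nat.add_sub_cancel' hle] at this
    linarith
  · have := hbound (q.1 - q.2) q.2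
    rw [Nat.add_sub_cancel' hle, hp3] at this
    linarith

/-- Nadler-type contraction theorem on partial metric spaces. -/
theorem nadler_multivalued_fixed_point
    {X : Type*} [Nonempty X] (p : X → X → ℝ)
    (hp1 : ∀ x y : X, 0 ≤ p x x ∧ p x x ≤ p x y)
    (hp2 : ∀ x y : X, x = y ↔ (p x x = p x y ∧ p x y = p y y))
    (hp3 : ∀ x y : X, p x y = p y x)
    (hp4 : ∀ x y z : X, p x y ≤ p x z + p z y - p z z)
    (hcomplete : pmComplete p)
    (T : X → Set X)
    (hT : ∀ x : X, (T x).Nonempty ∧ @IsClosed X (pmTop p) (T x) ∧ pmBounded p (T x))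
    (k : ℝ) (hk0 : 0 < k) (hk1 : k < 1)
    (hcontr : ∀ x y : X, pmH p (T x) (T y) ≤ k * p x y) :
    ∃ x : X, x ∈ T x := by
  by_contra! hfix
  have hnn : ∀ x y, 0 ≤ p x y := fun x y => (hp1 x y).1.trans (hp1 x y).2
  have hnear : ∀ x y, ∀ a ∈ T x, ∀ r, k * p x y < r → ∃ b ∈ T y, p a b < r :=
    fun x y a ha r hr =>
      exists_lt_of_pmH_lt hp1 hp3 hp4 (hT x).2.2 (hT y).1 ha ((hcontr x y).trans_lt hr)
  obtain ⟨h, hkh, hh1⟩ := exists_between hk1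
  have hh0 : 0 < h := hk0.trans hkh
  have hstep : ∀ q : {q : X × X // q.2 ∈ T q.1},
      ∃ z ∈ T q.1.2, p q.1.2 z ≤ h * p q.1.1 q.1.2 := by
    rintro ⟨⟨x, y⟩, hy⟩
    have hpos : 0 < p x y := by
      refine lt_of_le_of_ne (hnn x y) fun h0 => hfix x ?_
      have hxy : x = y := (hp2 x y).2
        ⟨by linarith [hnn x x, (hp1 x y).2],
         by linarith [hnn y y, (hp1 y x).2, hp3 x y]⟩
      rwa [← hxy] at hy
    obtain ⟨z, hz, hlt⟩ := hnear x y y hy (h * p x y) (by nlinarith)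
    exact ⟨z, hz, hlt.le⟩
  choose next hnext hdecay using hstep
  obtain ⟨x₀⟩ := ‹Nonempty X›
  obtain ⟨x₁, hx₁⟩ := (hT x₀).1
  let s : ℕ → {q : X × X // q.2 ∈ T q.1} := fun n =>
    Nat.rec ⟨(x₀, x₁), hx₁⟩ (fun _ q => ⟨(q.1.2, next q), hnext q⟩) n
  let x : ℕ → X := fun n => (s n).1.1
  have hmem : ∀ n, x (n + 1) ∈ T (x n) := fun n => (s n).2
  have hgeom : ∀ n, p (x n) (x (n + 1)) ≤ p x₀ x₁ * h ^ n := by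
    intro n
    induction n with
    | zero => simp [x, s]
    | succ n ih =>
      have hn : p (x (n + 1)) (x (n + 1 + 1)) ≤ h * p (x n) (x (n + 1)) := hdecay (s n)
      rw [pow_succ]
      nlinarith
  have hlim := tendsto_zero_of_le_geometric hp1 hp3 hp4 hh0.le hh1 hgeom
  obtain ⟨l, hl, hself⟩ := hcomplete x ⟨0, hlim⟩
  have hll : p l l = 0 := tendsto_nhds_unique hself
    (hlim.comp (Filter.tendsto_id.prodMk Filter.tendsto_id))
  rw [hll] at hl
  refine hfix l (mem_of_isClosed_of_forall_exists_lt hp4 (hT l).2.1 hll fun ε hε => ?_)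
  obtain ⟨n, hn, hn'⟩ := ((hl.eventually_lt_const (half_pos hε)).and
    ((hl.comp (Filter.tendsto_add_atTop_nat 1)).eventually_lt_const (half_pos hε))).exists
  have hn1 : p (x (n + 1)) l < ε / 2 := hn'
  obtain ⟨b, hb, hlt⟩ := hnear (x n) l (x (n + 1)) (hmem n) (ε / 2)
    (by nlinarith [hnn (x n) l])
  refine ⟨b, hb, ?_⟩
  linarith [hp4 l b (x (n + 1)), hp3 l (x (n + 1)), hnn (x (n + 1)) (x (n + 1))]
end

section
/- Let E be a real Banach space, P ⊆ E a cone (closed, P ≠ {0}, closed under nonnegative real linear combinations, P ∩ (−P) = {0}) ordered by x ≤ y iff y − x ∈ P, and assume P is normal with constant M > 0 (0 ≤ x ≤ y implies ‖x‖ ≤ M‖y‖). Let (X, p) be a partial cone metric space over (E, P), let k ∈ (0,1), and let (x_n)_{n≥0} be a sequence in X with p(x_{n+1}, x_n) ≤ k^n · p(x_1, x_0) for all n ≥ 1. Then for all m > n ≥ 1 one has p(x_m, x_n) ≤ (k^n/(1−k)) · p(x_1, x_0), hence ‖p(x_m, x_n)‖ ≤ (k^n/(1−k)) · M · ‖p(x_1,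 x_0)‖; in particular ‖p(x_m, x_n)‖ → 0 as n, m → ∞, so (x_n) is a Cauchy sequence in (X, p). -/
/-- The geometric-series estimate behind the Cauchy property, with the exact partial sum of the
series as coefficient. -/
lemma partial_cone_geometric_sum_bound {E X : Type*} [AddCommGroup E] [Module ℝ E] {P : Set E}
    (hadd : ∀ u ∈ P, ∀ v ∈ P, u + v ∈ P) {p : X → X → E}
    (hself : ∀ x : X, p x x ∈ P)
    (htri : ∀ x y z : X, p x z + p z y - p z z - p x y ∈ P)
    {k : ℝ} (hk : k < 1) {x : ℕ → X} {c : E}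
    (hx : ∀ n : ℕ, 1 ≤ n → k ^ n • c - p (x (n + 1)) (x n) ∈ P)
    {n m : ℕ} (hn : 1 ≤ n) (hm : n + 1 ≤ m) :
    ((k ^ n - k ^ m) / (1 - k)) • c - p (x m) (x n) ∈ P := by
  have hk' : 1 - k ≠ 0 := by linarith
  induction m, hm using Nat.le_induction with
  | base =>
    have h : (k ^ n - k ^ (n + 1)) / (1 - k) = k ^ n := by field_simp; ring
    rw [h]
    exact hx n hn
  | succ m hm ih =>
    have h : (k ^ n - k ^ (m + 1)) / (1 - k) = (k ^ n - k ^ m) / (1 - k) + k ^ m := by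
      field_simp; ring
    rw [h, add_smul]
    convert hadd _ (hadd _ (hadd _ ih _ (hx m (by omega))) _ (hself (x m))) _
      (htri (x (m + 1)) (x n) (x m)) using 1
    abel

/-- In a partial cone metric space over a normal cone `P` with constant `M`,
a sequence satisfying `p(x_{n+1}, x_n) ≤ k^n · p(x_1, x_0)` (with `k ∈ (0,1)`) satisfies
`p(x_m, x_n) ≤ (k^n/(1−k)) · p(x_1, x_0)` for `m > n ≥ 1`, hence
`‖p(x_m, x_n)‖ ≤ (k^n/(1−k)) · M · ‖p(x_1, x_0)‖`; in particular `‖p(x_m, x_n)‖ → 0`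
as `n, m → ∞`, so `(x_n)` is Cauchy in `(X, p)`. -/
theorem geometric_sequence_is_cauchy_in_partial_cone_metric
    {E : Type*} [NormedAddCommGroup E] [NormedSpace ℝ E] [CompleteSpace E]
    (P : Set E) (hPclosed : IsClosed P) (hPnonempty : P.Nonempty) (hPne : P ≠ {0})
    (hPcone : ∀ x ∈ P, ∀ y ∈ P, ∀ a b : ℝ, 0 ≤ a → 0 ≤ b → a • x + b • y ∈ P)
    (hPpointed : P ∩ (-P) = {0})
    (M : ℝ) (hM : 0 < M)
    (hPnormal : ∀ u v : E, u ∈ P → v - u ∈ P → ‖u‖ ≤ M * ‖v‖)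
    {X : Type*} [Nonempty X] (p : X → X → E)
    (hp1 : ∀ x y : X, p x x ∈ P ∧ p x y - p x x ∈ P)
    (hp2 : ∀ x y : X, x = y ↔ (p x x = p x y ∧ p x y = p y y))
    (hp3 : ∀ x y : X, p x y = p y x)
    (hp4 : ∀ x y z : X, p x z + p z y - p z z - p x y ∈ P)
    (k : ℝ) (hk0 : 0 < k) (hk1 : k < 1)
    (x : ℕ → X)
    (hx : ∀ n : ℕ, 1 ≤ n → k ^ n • p (x 1) (x 0) - p (x (n + 1)) (x n) ∈ P) :
    (∀ m n : ℕ, 1 ≤ n → n < m →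
        (k ^ n / (1 - k)) • p (x 1) (x 0) - p (x m) (x n) ∈ P) ∧
    (∀ m n : ℕ, 1 ≤ n → n < m →
        ‖p (x m) (x n)‖ ≤ k ^ n / (1 - k) * M * ‖p (x 1) (x 0)‖) ∧
    Filter.Tendsto (fun q : ℕ × ℕ => ‖p (x q.1) (x q.2)‖)
      (Filter.atTop ×ˢ Filter.atTop) (nhds 0) ∧
    (∃ a ∈ P, ∀ ε : ℝ, 0 < ε → ∃ N : ℕ, ∀ n m : ℕ, N < n → N < m →
        ‖p (x n) (x m) - a‖ < ε) := by
  have hadd : ∀ u ∈ P, ∀ v ∈ P, u + v ∈ P := fun u hu v hv => by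
    simpa using hPcone u hu v hv 1 1 zero_le_one zero_le_one
  have hsmul : ∀ u ∈ P, ∀ a : ℝ, 0 ≤ a → a • u ∈ P := fun u hu a ha => by
    simpa using hPcone u hu u hu a 0 ha le_rfl
  have hpos : ∀ y z : X, p y z ∈ P := fun y z => by
    simpa using hadd _ (hp1 y z).1 _ (hp1 y z).2
  have hk' : 0 < 1 - k := by linarith
  set c := p (x 1) (x 0)
  have hbound : ∀ m n : ℕ, 1 ≤ n → n < m → (k ^ n / (1 - k)) • c - p (x m) (x n) ∈ P := by
    intro m n hn hm
    convert hadd _ (partial_cone_geometric_sum_bound hadd (fun y => (hp1 y y).1) hp4 hk1 hx hn hm)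
      _ (hsmul c (hpos _ _) (k ^ m / (1 - k)) (by positivity)) using 1
    rw [sub_div, sub_smul]
    abel
  have hnorm_of_mem : ∀ (n : ℕ) (u : E), u ∈ P → (k ^ n / (1 - k)) • c - u ∈ P →
      ‖u‖ ≤ k ^ n / (1 - k) * M * ‖c‖ := by
    intro n u hu huc
    have hcoeff : 0 ≤ k ^ n / (1 - k) := by positivity
    calc ‖u‖ ≤ M * ‖(k ^ n / (1 - k)) • c‖ := hPnormal _ _ hu huc
      _ = k ^ n / (1 - k) * M * ‖c‖ := by
        rw [norm_smul, Real.norm_of_nonneg hcoeff]; ring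
  have hnorm : ∀ m n : ℕ, 1 ≤ n → n < m →
      ‖p (x m) (x n)‖ ≤ k ^ n / (1 - k) * M * ‖c‖ :=
    fun m n hn hm => hnorm_of_mem n _ (hpos _ _) (hbound m n hn hm)
  have hdiag : ∀ n : ℕ, 1 ≤ n → ‖p (x n) (x n)‖ ≤ k ^ n / (1 - k) * M * ‖c‖ := by
    intro n hn
    refine hnorm_of_mem n _ (hpos _ _) ?_
    have h := hadd _ (hbound (n + 1) n hn n.lt_succ_self) _ (hp1 (x n) (x (n + 1))).2
    rwa [hp3 (x n) (x (n + 1)), sub_add_sub_cancel] at h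
  have hsum : ∀ m n : ℕ, 1 ≤ m → 1 ≤ n → ‖p (x m) (x n)‖ ≤
      k ^ m / (1 - k) * M * ‖c‖ + k ^ n / (1 - k) * M * ‖c‖ := by
    intro m n hm hn
    have h₁ : 0 ≤ k ^ m / (1 - k) * M * ‖c‖ := by positivity
    have h₂ : 0 ≤ k ^ n / (1 - k) * M * ‖c‖ := by positivity
    rcases lt_trichotomy m n with h | rfl | h
    · rw [hp3]
      linarith [hnorm n m hm h]
    · linarith [hdiag m hm]
    · linarith [hnorm m n hn h]
  have hgeom : Filter.Tendsto (fun n : ℕ => k ^ n / (1 - k) * M * ‖c‖) Filter.atTop (nhds 0) := by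
    simpa using (((tendsto_pow_atTop_nhds_zero_of_lt_one hk0.le hk1).div_const (1 - k)).mul_const
      M).mul_const ‖c‖
  have hlim : Filter.Tendsto (fun q : ℕ × ℕ => ‖p (x q.1) (x q.2)‖)
      (Filter.atTop ×ˢ Filter.atTop) (nhds 0) := by
    refine squeeze_zero' (Filter.Eventually.of_forall fun _ => norm_nonneg _) ?_
      (by simpa using (hgeom.comp Filter.tendsto_fst).add (hgeom.comp Filter.tendsto_snd))
    filter_upwards [(Filter.eventually_ge_atTop 1).prod_mk (Filter.eventually_ge_atTop 1)]
      with q hq using hsum q.1 q.2 hq.1 hq.2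
  refine ⟨hbound, hnorm, hlim, 0, ?_, fun ε hε => ?_⟩
  · simpa using hsmul c (hpos _ _) 0 le_rfl
  · have hev := hlim.eventually (gt_mem_nhds hε)
    rw [Filter.prod_atTop_atTop_eq, Filter.eventually_atTop] at hev
    obtain ⟨⟨a, b⟩, hab⟩ := hev
    refine ⟨max a b, fun n m hn hm => ?_⟩
    rw [sub_zero]
    exact hab (n, m) ⟨(le_max_left a b).trans hn.le, (le_max_right a b).trans hm.le⟩
end
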